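/- For every integer k ≥ 3, every pattern p ∈ S_k, and every n > k, the set S_n{p} = {w ∈ S_n : w avoids p} is not an order ideal in the Bruhat order on S_n; that is, there exist w ∈ S_n{p} and v ≤ w with v ∉ S_n{p}. -/

import Mathlib

namespace Paper

/-! ### Type A: the symmetric group `S_n` as `Equiv.Perm (Fin n)` -/

/-- The simple transposition `s_i ∈ S_n` (1-indexed letter `i`, meaningful for
`1 ≤ i ≤ n-1`): it interchanges the entries in (1-indexed) positions `i` and `i+1`,
i.e. (0-indexed) positions `i-1` and `i` of `Fin n`. Out-of-range letters give `1`. -/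
def sA (n : ℕ) (i : ℕ) : Equiv.Perm (Fin n) :=
  if h : 1 ≤ i ∧ i < n then Equiv.swap ⟨i - 1, by omega⟩ ⟨i, h.2⟩ else 1

/-- The product `s_{i_1} ⋯ s_{i_ℓ}` of a word `i_1 ⋯ i_ℓ`. -/
def prodA (n : ℕ) (w : List ℕ) : Equiv.Perm (Fin n) := (w.map (sA n)).prod

/-- A word in the letters `{1, …, n-1}`. -/
def IsWordA (n : ℕ) (w : List ℕ) : Prop := ∀ i ∈ w, 1 ≤ i ∧ i ≤ n - 1

/-- `w` is a reduced decomposition of `x ∈ S_n`. -/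
def ReducedA (n : ℕ) (w : List ℕ) (x : Equiv.Perm (Fin n)) : Prop :=
  IsWordA n w ∧ prodA n w = x ∧
    ∀ w' : List ℕ, IsWordA n w' → prodA n w' = x → w.length ≤ w'.length

/-- The Coxeter length `ℓ(x)`: minimal length of a word for `x`. -/
noncomputable def lenA (n : ℕ) (x : Equiv.Perm (Fin n)) : ℕ :=
  sInf {l | ∃ w : List ℕ, IsWordA n w ∧ prodA n w = x ∧ w.length = l}

/-- Bruhat order on `S_n`: `v ≤ w` iff some reduced decomposition of `v` is a
(not necessarily consecutive) subword of some reduced decomposition of `w`. -/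
def bruhatA (n : ℕ) (v w : Equiv.Perm (Fin n)) : Prop :=
  ∃ a b : List ℕ, ReducedA n a v ∧ ReducedA n b w ∧ a.Sublist b

/-- `w ∈ S_n` is boolean: the principal order ideal `B(w)`, ordered by the Bruhat
order, is order-isomorphic to the lattice of all subsets of `{1,…,r}` for some `r`. -/
def BooleanA (n : ℕ) (w : Equiv.Perm (Fin n)) : Prop :=
  ∃ (r : ℕ) (e : {v : Equiv.Perm (Fin n) // bruhatA n v w} ≃ Finset (Fin r)),
    ∀ a b : {v : Equiv.Perm (Fin n) // bruhatA n v w}, bruhatA n a.1 b.1 ↔ e a ⊆ e b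

/-- Pattern containment: `w ∈ S_n` contains `p ∈ S_k`. -/
def ContainsA {n k : ℕ} (w : Equiv.Perm (Fin n)) (p : Equiv.Perm (Fin k)) : Prop :=
  ∃ f : Fin k → Fin n, StrictMono f ∧ ∀ a b : Fin k, w (f a) < w (f b) ↔ p a < p b

/-- Pattern avoidance. -/
def AvoidsA {n k : ℕ} (w : Equiv.Perm (Fin n)) (p : Equiv.Perm (Fin k)) : Prop :=
  ¬ ContainsA w p

/-- The pattern `321` (one-line notation). -/
def p321 : Equiv.Perm (Fin 3) := ⟨![2,1,0], ![2,1,0], by decide, by decide⟩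
/-- The pattern `231` (one-line notation). -/
def p231 : Equiv.Perm (Fin 3) := ⟨![1,2,0], ![2,0,1], by decide, by decide⟩
/-- The pattern `312` (one-line notation). -/
def p312 : Equiv.Perm (Fin 3) := ⟨![2,0,1], ![1,2,0], by decide, by decide⟩
/-- The pattern `3412` (one-line notation). -/
def p3412 : Equiv.Perm (Fin 4) := ⟨![2,3,0,1], ![2,3,0,1], by decide, by decide⟩

/-- The longest (decreasing) permutation `w_0^{(k)} = k (k-1) ⋯ 2 1 ∈ S_k`. -/
def w0 (k : ℕ) : Equiv.Perm (Fin k) := Fin.revPerm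

/-- The shift of a word by `M`: each letter `i` becomes `i + M`. -/
def shift (M : ℕ) (w : List ℕ) : List ℕ := w.map (· + M)




/-! ### Types B and D: signed permutations, modelled as permutations `w` of `ℤ`
with `w(-x) = -w(x)` that fix all integers of absolute value `> n`. -/

/-- The simple generators of `S_n^B`, as permutations of `ℤ`:
`sB 0` negates the value `1`; for `i ≥ 1`, `sB i` interchanges the values
`i` and `i+1` (and `-i` and `-(i+1)`). -/
def sB : ℕ → Equiv.Perm ℤ
  | 0 => Equiv.swap 1 (-1)
  | (i+1) => Equiv.swap ((i : ℤ) + 1) ((i : ℤ) + 2) * Equiv.swap (-((i : ℤ) + 1)) (-((i : ℤ) + 2))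

/-- The simple generators of `S_n^D`: letter `0` encodes `s_{1'} = s_0 s_1 s_0`
(mapping `1 ↦ -2` and `2 ↦ -1`), and letters `i ≥ 1` are as in type `B`. -/
def sD : ℕ → Equiv.Perm ℤ
  | 0 => sB 0 * sB 1 * sB 0
  | (i+1) => sB (i+1)

def prodB (w : List ℕ) : Equiv.Perm ℤ := (w.map sB).prod
def prodD (w : List ℕ) : Equiv.Perm ℤ := (w.map sD).prod

/-- A word in the type `B`/`D` letters `{0, 1, …, n-1}`. -/
def IsWordBD (n : ℕ) (w : List ℕ) : Prop := ∀ i ∈ w, i ≤ n - 1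

/-- `w` is a reduced decomposition of `x ∈ S_n^B`. -/
def ReducedB (n : ℕ) (w : List ℕ) (x : Equiv.Perm ℤ) : Prop :=
  IsWordBD n w ∧ prodB w = x ∧
    ∀ w' : List ℕ, IsWordBD n w' → prodB w' = x → w.length ≤ w'.length

/-- `w` is a reduced decomposition of `x ∈ S_n^D`. -/
def ReducedD (n : ℕ) (w : List ℕ) (x : Equiv.Perm ℤ) : Prop :=
  IsWordBD n w ∧ prodD w = x ∧
    ∀ w' : List ℕ, IsWordBD n w' → prodD w' = x → w.length ≤ w'.length

/-- Length in `S_n^B`. -/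
noncomputable def lenB (n : ℕ) (x : Equiv.Perm ℤ) : ℕ :=
  sInf {l | ∃ w : List ℕ, IsWordBD n w ∧ prodB w = x ∧ w.length = l}

/-- Length in `S_n^D`. -/
noncomputable def lenD (n : ℕ) (x : Equiv.Perm ℤ) : ℕ :=
  sInf {l | ∃ w : List ℕ, IsWordBD n w ∧ prodD w = x ∧ w.length = l}

/-- Bruhat order on `S_n^B`. -/
def bruhatB (n : ℕ) (v w : Equiv.Perm ℤ) : Prop :=
  ∃ a b : List ℕ, ReducedB n a v ∧ ReducedB n b w ∧ a.Sublist b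

/-- Bruhat order on `S_n^D`. -/
def bruhatD (n : ℕ) (v w : Equiv.Perm ℤ) : Prop :=
  ∃ a b : List ℕ, ReducedD n a v ∧ ReducedD n b w ∧ a.Sublist b

/-- `w` is an element of `S_n^B`: an "odd" permutation of `{±1, …, ±n}`. -/
def IsSignedPerm (n : ℕ) (w : Equiv.Perm ℤ) : Prop :=
  (∀ x : ℤ, w (-x) = - w x) ∧ ∀ x : ℤ, (n : ℤ) < |x| → w x = x

/-- `w` is an element of `S_n^D`: a signed permutation with an even number of
negative values in its one-line notation. -/
def IsTypeD (n : ℕ) (w : Equiv.Perm ℤ) : Prop :=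
  IsSignedPerm n w ∧ Even (((Finset.Icc (1 : ℤ) n).filter (fun x => w x < 0)).card)

/-- `w ∈ S_n^B` is boolean (for the type `B` Bruhat order). -/
def BooleanB (n : ℕ) (w : Equiv.Perm ℤ) : Prop :=
  ∃ (r : ℕ) (e : {v : Equiv.Perm ℤ // bruhatB n v w} ≃ Finset (Fin r)),
    ∀ a b : {v : Equiv.Perm ℤ // bruhatB n v w}, bruhatB n a.1 b.1 ↔ e a ⊆ e b

/-- `w ∈ S_n^D` is boolean (for the type `D` Bruhat order). -/
def BooleanD (n : ℕ) (w : Equiv.Perm ℤ) : Prop :=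
  ∃ (r : ℕ) (e : {v : Equiv.Perm ℤ // bruhatD n v w} ≃ Finset (Fin r)),
    ∀ a b : {v : Equiv.Perm ℤ // bruhatD n v w}, bruhatD n a.1 b.1 ↔ e a ⊆ e b

/-- Signed pattern containment, where the pattern is given by its one-line
notation `p` (a list of nonzero integers): there are positions
`1 ≤ f 0 < ⋯ < f (k-1) ≤ n` such that each `w (f j)` has the same sign as the
`j`-th entry of `p`, and the absolute values appear in the same relative order. -/
def containsPat (n : ℕ) (w : Equiv.Perm ℤ) (p : List ℤ) : Prop :=
  ∃ f : Fin p.length → ℤ, StrictMono f ∧ (∀ j, 1 ≤ f j ∧ f j ≤ (n : ℤ)) ∧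
    (∀ j, 0 < w (f j) ↔ 0 < p.get j) ∧
    (∀ j j', |w (f j)| < |w (f j')| ↔ |p.get j| < |p.get j'|)

/-- Signed pattern avoidance. -/
def avoidsPat (n : ℕ) (w : Equiv.Perm ℤ) (p : List ℤ) : Prop := ¬ containsPat n w p


/-! ### Extra definitions used in some statements -/

/-- `w ∈ S_n` is decomposable: `B(w) ≅ B(u) × B(v)` (as posets under Bruhat order)
for some `u ∈ S_m`, `v ∈ S_{m'}` with `m, m' < n`. -/
def Decomposable (n : ℕ) (w : Equiv.Perm (Fin n)) : Prop :=
  ∃ (m m' : ℕ), m < n ∧ m' < n ∧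
    ∃ (u : Equiv.Perm (Fin m)) (v : Equiv.Perm (Fin m'))
      (e : {x : Equiv.Perm (Fin n) // bruhatA n x w} ≃
        {y : Equiv.Perm (Fin m) // bruhatA m y u} × {z : Equiv.Perm (Fin m') // bruhatA m' z v}),
      ∀ a b : {x : Equiv.Perm (Fin n) // bruhatA n x w},
        bruhatA n a.1 b.1 ↔
          (bruhatA m ((e a).1).1 ((e b).1).1 ∧ bruhatA m' ((e a).2).1 ((e b).2).1)

/-- `w` is decreasing on the set of positions `T`. -/
def DecrOn (n : ℕ) (w : Equiv.Perm (Fin n)) (T : Finset (Fin n)) : Prop :=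
  ∀ a ∈ T, ∀ b ∈ T, a < b → w b < w a

/-- Every inversion of `w` lies in exactly one occurrence of the decreasing
pattern `w_0^{(k)}`: for every `i < j` with `w i > w j` there is exactly one
`k`-element set of positions containing `i` and `j` on which `w` is decreasing. -/
def EveryInvOnce (n k : ℕ) (w : Equiv.Perm (Fin n)) : Prop :=
  ∀ i j : Fin n, i < j → w j < w i →
    ∃! T : Finset (Fin n), T.card = k ∧ DecrOn n w T ∧ i ∈ T ∧ j ∈ T

/-- Equality of two patterns of (possibly a priori different) sizes. -/
def EqPat {k m : ℕ} (p : Equiv.Perm (Fin k)) (q : Equiv.Perm (Fin m)) : Prop :=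
  ∃ h : k = m, ∀ i : Fin k, ((p i : ℕ) = (q (Fin.cast h i) : ℕ))

/-- `L(n,k)`: the number of boolean permutations in `S_n` of length `k`. -/
noncomputable def LA (n k : ℕ) : ℕ :=
  Nat.card {w : Equiv.Perm (Fin n) // BooleanA n w ∧ lenA n w = k}

/-- `L` extended to integer arguments, with the convention that it vanishes
when `m < 1` or `j < 0`. -/
noncomputable def Lz (m j : ℤ) : ℤ :=
  if 1 ≤ m ∧ 0 ≤ j then (LA m.toNat j.toNat : ℤ) else 0

/-- `L^D(n,k)`: the number of boolean elements of `S_n^D` of length `k`. -/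
noncomputable def LD (n k : ℕ) : ℕ :=
  Nat.card {w : Equiv.Perm ℤ // IsTypeD n w ∧ BooleanD n w ∧ lenD n w = k}

/-- Inversion set. -/
def invSet {n : ℕ} (x : Equiv.Perm (Fin n)) : Finset (Fin n × Fin n) :=
  Finset.univ.filter (fun q => q.1 < q.2 ∧ x q.2 < x q.1)

lemma mem_invSet {n : ℕ} (x : Equiv.Perm (Fin n)) (a b : Fin n) :
    (a, b) ∈ invSet x ↔ a < b ∧ x b < x a := by
  simp [invSet]

def invNum {n : ℕ} (x : Equiv.Perm (Fin n)) : ℕ := (invSet x).card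

lemma sA_eq (n i : ℕ) (h1 : 1 ≤ i) (h2 : i < n) :
    sA n i = Equiv.swap ⟨i - 1, by omega⟩ ⟨i, h2⟩ := by
  simp [sA, h1, h2]

lemma sA_val (n i : ℕ) (h1 : 1 ≤ i) (h2 : i < n) (x : Fin n) :
    ((sA n i x : Fin n) : ℕ) =
      if (x : ℕ) = i - 1 then i else if (x : ℕ) = i then i - 1 else x := by
  rw [sA_eq n i h1 h2, Equiv.swap_apply_def]
  simp only [Fin.ext_iff]
  split_ifs <;> rfl

lemma sA_sA (n i : ℕ) : sA n i * sA n i = 1 := by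
  unfold sA
  split_ifs
  · exact Equiv.swap_mul_self _ _
  · simp

lemma sA_sA_apply (n i : ℕ) (x : Fin n) : sA n i (sA n i x) = x := by
  rw [← Equiv.Perm.mul_apply, sA_sA]; rfl

lemma invSet_asc {n : ℕ} (x : Equiv.Perm (Fin n)) (i : ℕ) (h1 : 1 ≤ i) (h2 : i < n)
    (h : x ⟨i - 1, by omega⟩ < x ⟨i, h2⟩) :
    invNum (x * sA n i) = invNum x + 1 := by
  have key : invSet (x * sA n i) = insert ((⟨i - 1, by omega⟩ : Fin n), (⟨i, h2⟩ : Fin n))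
      ((invSet x).map (Equiv.prodCongr (sA n i) (sA n i)).toEmbedding) := by
    ext ⟨a, b⟩
    have hs : (Equiv.prodCongr (sA n i) (sA n i)).symm (a, b) = (sA n i a, sA n i b) := by
      rw [Equiv.symm_apply_eq]
      simp [sA_sA_apply]
    rw [Finset.mem_insert, Finset.mem_map_equiv, hs]
    have ha := sA_val n i h1 h2 a
    have hb := sA_val n i h1 h2 b
    simp only [mem_invSet, Equiv.Perm.mul_apply,
      Prod.mk.injEq]
    constructor
    · rintro ⟨hab, hx⟩
      by_cases hc : (a : ℕ) = i - 1 ∧ (b : ℕ) = i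
      · left; exact ⟨Fin.ext hc.1, Fin.ext hc.2⟩
      · right
        refine ⟨?_, hx⟩
        rw [Fin.lt_def] at hab ⊢
        rw [ha, hb]
        split_ifs <;> omega
    · rintro (⟨rfl, rfl⟩ | ⟨hab, hx⟩)
      · refine ⟨?_, ?_⟩
        · rw [Fin.lt_def]; simp only; omega
        · have e1 : sA n i ⟨i - 1, by omega⟩ = ⟨i, h2⟩ := by
            apply Fin.ext; rw [sA_val n i h1 h2]; simp
          have e2 : sA n i ⟨i, h2⟩ = ⟨i - 1, by omega⟩ := by
            apply Fin.ext; rw [sA_val n i h1 h2]; simp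
          rw [e1, e2]; exact h
      · refine ⟨?_, hx⟩
        by_cases hc : (sA n i a : ℕ) = i - 1 ∧ (sA n i b : ℕ) = i
        · exfalso
          rw [show sA n i a = ⟨i - 1, by omega⟩ from Fin.ext hc.1,
            show sA n i b = ⟨i, h2⟩ from Fin.ext hc.2] at hx
          exact absurd hx (not_lt.mpr h.le)
        · rw [Fin.lt_def] at hab ⊢
          rw [ha, hb] at hab hc
          split_ifs at hab hc <;> omega
  unfold invNum
  rw [key, Finset.card_insert_of_notMem, Finset.card_map]
  rw [Finset.mem_map_equiv]
  have hs : (Equiv.prodCongr (sA n i) (sA n i)).symm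
      ((⟨i - 1, by omega⟩ : Fin n), (⟨i, h2⟩ : Fin n)) =
      (sA n i ⟨i - 1, by omega⟩, sA n i ⟨i, h2⟩) := by
    rw [Equiv.symm_apply_eq]
    simp [sA_sA_apply]
  rw [hs]
  simp only [mem_invSet, not_and]
  intro hl
  rw [Fin.lt_def, sA_val n i h1 h2, sA_val n i h1 h2] at hl
  simp only at hl
  split_ifs at hl <;> omega

lemma invNum_desc {n : ℕ} (x : Equiv.Perm (Fin n)) (i : ℕ) (h1 : 1 ≤ i) (h2 : i < n)
    (h : x ⟨i, h2⟩ < x ⟨i - 1, by omega⟩) :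
    invNum (x * sA n i) + 1 = invNum x := by
  have := invSet_asc (x * sA n i) i h1 h2 (by
    have e1 : sA n i ⟨i - 1, by omega⟩ = ⟨i, h2⟩ := by
      apply Fin.ext; rw [sA_val n i h1 h2]; simp
    have e2 : sA n i ⟨i, h2⟩ = ⟨i - 1, by omega⟩ := by
      apply Fin.ext; rw [sA_val n i h1 h2]; simp
    rw [Equiv.Perm.mul_apply, Equiv.Perm.mul_apply, e1, e2]; exact h)
  rw [mul_assoc, sA_sA, mul_one] at this
  omega

lemma invNum_le {n : ℕ} (x : Equiv.Perm (Fin n)) (i : ℕ) :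
    invNum (x * sA n i) ≤ invNum x + 1 := by
  by_cases hi : 1 ≤ i ∧ i < n
  · obtain ⟨h1, h2⟩ := hi
    rcases lt_trichotomy (x ⟨i - 1, by omega⟩) (x ⟨i, h2⟩) with h | h | h
    · exact (invSet_asc x i h1 h2 h).le
    · have := congrArg Fin.val (x.injective h)
      simp only at this
      omega
    · have := invNum_desc x i h1 h2 h
      omega
  · simp [sA, hi]

lemma invNum_one {n : ℕ} : invNum (1 : Equiv.Perm (Fin n)) = 0 := by
  unfold invNum invSet
  rw [Finset.card_eq_zero, Finset.filter_eq_empty_iff]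
  rintro q - ⟨h, h'⟩
  exact absurd h (not_lt.mpr h'.le)

lemma prodA_append (n : ℕ) (a b : List ℕ) : prodA n (a ++ b) = prodA n a * prodA n b := by
  simp [prodA]

lemma prodA_single (n i : ℕ) : prodA n [i] = sA n i := by
  simp [prodA]

lemma invNum_prodA_le (n : ℕ) (a : List ℕ) : invNum (prodA n a) ≤ a.length := by
  induction a using List.reverseRecOn with
  | nil => simp [prodA, invNum_one]
  | append_singleton a i ih =>
    rw [prodA_append, prodA_single, List.length_append, List.length_singleton]
    exact (invNum_le _ _).trans (by omega)

/-- Words of length equal to the inversion number. -/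
def RW (n : ℕ) (a : List ℕ) (x : Equiv.Perm (Fin n)) : Prop :=
  IsWordA n a ∧ prodA n a = x ∧ a.length = invNum x

lemma RW.reduced {n : ℕ} {a : List ℕ} {x : Equiv.Perm (Fin n)} (h : RW n a x) :
    ReducedA n a x := by
  refine ⟨h.1, h.2.1, fun b _ hb => ?_⟩
  rw [h.2.2, ← hb]
  exact invNum_prodA_le n b

lemma RW.snoc {n : ℕ} {a : List ℕ} {x : Equiv.Perm (Fin n)} (ha : RW n a x)
    (i : ℕ) (h1 : 1 ≤ i) (h2 : i < n) (h : x ⟨i - 1, by omega⟩ < x ⟨i, h2⟩) :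
    RW n (a ++ [i]) (x * sA n i) := by
  refine ⟨?_, ?_, ?_⟩
  · intro j hj
    rcases List.mem_append.mp hj with hj | hj
    · exact ha.1 j hj
    · rw [List.mem_singleton.mp hj]; omega
  · rw [prodA_append, prodA_single, ha.2.1]
  · rw [invSet_asc x i h1 h2 h, List.length_append, ha.2.2]; rfl

/-- If there is no descent then the function is monotone. -/
lemma strictMono_of_steps {n : ℕ} (g : Fin n → Fin n)
    (h : ∀ i (_ : 1 ≤ i) (h2 : i < n), g ⟨i - 1, by omega⟩ < g ⟨i, h2⟩) : StrictMono g := by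
  have key : ∀ d (a : ℕ) (hb : a + d + 1 < n), g ⟨a, by omega⟩ < g ⟨a + d + 1, hb⟩ := by
    intro d
    induction d with
    | zero => intro a hb; exact h (a + 1) (by omega) hb
    | succ d ih =>
      intro a hb
      exact (ih a (by omega)).trans (h (a + (d + 1) + 1) (by omega) hb)
  intro a b hab
  rw [Fin.lt_def] at hab
  have := key (b - a - 1) a (by omega)
  have e : (⟨(a : ℕ) + (b - a - 1) + 1, by omega⟩ : Fin n) = b := Fin.ext (by simp only; omega)
  rw [e] at this
  exact this

lemma perm_eq_one {n : ℕ} (x : Equiv.Perm (Fin n)) (h : StrictMono x) : x = 1 := by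
  have := Subsingleton.elim (StrictMono.orderIsoOfSurjective x h x.surjective) (OrderIso.refl _)
  ext a
  have := DFunLike.congr_fun this a
  simpa using congrArg Fin.val this

lemma exists_RW {n : ℕ} : ∀ (m : ℕ) (x : Equiv.Perm (Fin n)), invNum x = m → ∃ a, RW n a x := by
  intro m
  induction m with
  | zero =>
    intro x hx
    have : x = 1 := by
      apply perm_eq_one
      intro a b hab
      by_contra hc
      have hm : (a, b) ∈ invSet x := by
        simp only [mem_invSet]
        refine ⟨hab, lt_of_le_of_ne (not_lt.mp hc) ?_⟩
        intro e
        exact hab.ne' (x.injective e)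
      rw [Finset.card_eq_zero.mp hx] at hm
      simp at hm
    subst this
    exact ⟨[], by simp [IsWordA], by simp [prodA], by simp [invNum_one]⟩
  | succ m ih =>
    intro x hx
    by_cases hd : ∃ i, ∃ (h1 : 1 ≤ i) (h2 : i < n), x ⟨i, h2⟩ < x ⟨i - 1, by omega⟩
    · obtain ⟨i, h1, h2, h⟩ := hd
      have hh := invNum_desc x i h1 h2 h
      obtain ⟨a, ha⟩ := ih (x * sA n i) (by omega)
      refine ⟨a ++ [i], ?_⟩
      have := ha.snoc i h1 h2 (by
        have e1 : sA n i ⟨i - 1, by omega⟩ = ⟨i, h2⟩ := by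
          apply Fin.ext; rw [sA_val n i h1 h2]; simp
        have e2 : sA n i ⟨i, h2⟩ = ⟨i - 1, by omega⟩ := by
          apply Fin.ext; rw [sA_val n i h1 h2]; simp
        rw [Equiv.Perm.mul_apply, Equiv.Perm.mul_apply, e1, e2]; exact h)
      rwa [mul_assoc, sA_sA, mul_one] at this
    · push Not at hd
      have : x = 1 := by
        apply perm_eq_one
        apply strictMono_of_steps
        intro i h1 h2
        refine lt_of_le_of_ne (hd i h1 h2) ?_
        intro e
        have := congrArg Fin.val (x.injective e)
        simp only at this
        omega
      rw [this, invNum_one] at hx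
      omega

lemma invNum_bound {n : ℕ} (x : Equiv.Perm (Fin n)) : invNum x ≤ n * n := by
  have := Finset.card_le_univ (invSet x)
  simpa [invNum] using this

/-- Every word extends to a word for the longest element. -/
lemma extend_w0 {n : ℕ} : ∀ (m : ℕ) (x : Equiv.Perm (Fin n)) (a : List ℕ), RW n a x →
    n * n - invNum x = m → ∃ b, RW n (a ++ b) (w0 n) := by
  intro m
  induction m using Nat.strong_induction_on with
  | _ m ih =>
    intro x a ha hm
    by_cases hd : ∃ i, ∃ (h1 : 1 ≤ i) (h2 : i < n), x ⟨i - 1, by omega⟩ < x ⟨i, h2⟩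
    · obtain ⟨i, h1, h2, h⟩ := hd
      have hi := invSet_asc x i h1 h2 h
      have hb := invNum_bound (x * sA n i)
      obtain ⟨b, hb⟩ := ih (n * n - invNum (x * sA n i)) (by omega) _ _ (ha.snoc i h1 h2 h) rfl
      exact ⟨i :: b, by simpa using hb⟩
    · push Not at hd
      have : x = w0 n := by
        have h1 : (w0 n) * x = 1 := by
          apply perm_eq_one
          apply strictMono_of_steps
          intro i h1 h2
          simp only [w0, Equiv.Perm.mul_apply, Fin.revPerm_apply, Fin.rev_lt_rev]
          refine lt_of_le_of_ne (hd i h1 h2) ?_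
          intro e
          have := congrArg Fin.val (x.injective e)
          simp only at this
          omega
        ext j
        have := DFunLike.congr_fun h1 j
        simp only [w0, Equiv.Perm.mul_apply, Fin.revPerm_apply, Equiv.Perm.one_apply] at this
        simp only [w0, Fin.revPerm_apply]
        rw [← this, Fin.rev_rev, this]
      subst this
      exact ⟨[], by simpa using ha⟩

set_option maxHeartbeats 2000000 in
theorem stmt12 (k : ℕ) (hk : 3 ≤ k) (p : Equiv.Perm (Fin k)) (n : ℕ) (hn : k < n) :
    ∃ w v : Equiv.Perm (Fin n), AvoidsA w p ∧ bruhatA n v w ∧ ContainsA v p := by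
  have hkn : k ≤ n := hn.le
  set v : Equiv.Perm (Fin n) := p.viaFintypeEmbedding (Fin.castLEEmb hkn) with hv
  have hv1 : ∀ a : Fin k, v (Fin.castLE hkn a) = Fin.castLE hkn (p a) := fun a =>
    Equiv.Perm.viaFintypeEmbedding_apply_image p (Fin.castLEEmb hkn) a
  have hv2 : ∀ b : Fin n, k ≤ (b : ℕ) → v b = b := by
    intro b hb
    apply Equiv.Perm.viaFintypeEmbedding_apply_notMem_range
    rintro ⟨a, rfl⟩
    have := a.2
    simp at hb
    omega
  have hc : ContainsA v p := by
    refine ⟨Fin.castLE hkn, fun a b h => h, fun a b => ?_⟩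
    rw [hv1, hv1]
    exact Iff.rfl
  by_cases hp : StrictAnti p
  · -- the decreasing pattern
    have hpa : ∀ a : Fin k, (p a : ℕ) = k - 1 - a := by
      have h1 : Fin.revPerm * p = 1 := by
        apply perm_eq_one
        intro a b hab
        simpa using hp hab
      intro a
      have := DFunLike.congr_fun h1 a
      simp only [Equiv.Perm.mul_apply, Fin.revPerm_apply, Equiv.Perm.one_apply] at this
      have := congrArg Fin.val this
      rw [Fin.val_rev] at this
      have := (p a).2
      omega
    have hvv : ∀ b : Fin n, (v b : ℕ) = if (b : ℕ) < k then k - 1 - b else b := by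
      intro b
      split_ifs with hb
      · have := congrArg Fin.val (hv1 ⟨b, hb⟩)
        simpa [hpa] using this
      · rw [hv2 b (by omega)]
    have s1 := sA_val n (k - 1) (by omega) (by omega)
    have s2 := sA_val n k (by omega) hn
    obtain ⟨a, ha⟩ := exists_RW _ (v * sA n (k - 1)) rfl
    have R1 := ha.snoc (k - 1) (by omega) (by omega) (by
      rw [Fin.lt_def]
      simp only [Equiv.Perm.mul_apply, hvv, s1]
      split_ifs <;> omega)
    have R2 := ha.snoc k (by omega) hn (by
      rw [Fin.lt_def]
      simp only [Equiv.Perm.mul_apply, hvv, s1]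
      split_ifs <;> omega)
    have R3 := R2.snoc (k - 1) (by omega) (by omega) (by
      rw [Fin.lt_def]
      simp only [Equiv.Perm.mul_apply, hvv, s1, s2]
      split_ifs <;> omega)
    rw [mul_assoc, sA_sA, mul_one] at R1
    refine ⟨_, v, ?_, ⟨_, _, R1.reduced, R3.reduced, ?_⟩, hc⟩
    · rintro ⟨f, hf, hfw⟩
      have hw : ∀ b : Fin n, ((v * sA n (k - 1) * sA n k * sA n (k - 1)) b : ℕ) =
          if (b : ℕ) < k - 2 then k - 1 - b else if (b : ℕ) = k - 2 then k else
          if (b : ℕ) = k - 1 then 0 else if (b : ℕ) = k then 1 else b := by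
        intro b
        simp only [Equiv.Perm.mul_apply, hvv, s1, s2]
        split_ifs <;> omega
      let c : Fin n → Fin (k - 1) := fun b =>
        if h : (b : ℕ) < k - 2 then ⟨b, by omega⟩ else
          if (b : ℕ) = k - 1 ∨ (b : ℕ) = k then ⟨k - 2, by omega⟩ else ⟨0, by omega⟩
      have hcv : ∀ b, (c b : ℕ) = if (b : ℕ) < k - 2 then (b : ℕ) else
          if (b : ℕ) = k - 1 ∨ (b : ℕ) = k then k - 2 else 0 := by
        intro b
        simp only [c]
        split_ifs <;> rfl
      obtain ⟨i, j, hij, he⟩ := Fintype.exists_ne_map_eq_of_card_lt (fun a => c (f a))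
        (by simp; omega)
      have main : ∀ i j : Fin k, i < j → c (f i) = c (f j) → False := by
        intro i j hij he
        have h1 := (hfw j i).mpr (hp hij)
        have h2 := hf hij
        have h3 := congrArg Fin.val he
        rw [hcv, hcv] at h3
        rw [Fin.lt_def] at h1 h2
        rw [hw, hw] at h1
        split_ifs at h1 h3 <;> omega
      rcases lt_or_gt_of_ne hij with h | h
      · exact main i j h he
      · exact main j i h he.symm
    · rw [List.append_assoc]
      exact List.Sublist.append_left (by simp) a
  · obtain ⟨a, ha⟩ := exists_RW _ v rfl
    obtain ⟨b, hb⟩ := extend_w0 _ v a ha rfl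
    refine ⟨w0 n, v, ?_, ⟨a, a ++ b, ha.reduced, hb.reduced, List.sublist_append_left a b⟩, hc⟩
    rintro ⟨f, hf, hfw⟩
    apply hp
    intro i j hij
    rw [← hfw j i]
    simpa [w0] using hf hij

end Paper
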